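/- arXiv:1503.02173 — 6 statements merged into one kernel-verified Lean document; each statement's English description precedes it below -/
import Mathlib

section
/- Let K be a field and let m₀ = (X₁, X₂, X₃) be the maximal ideal of K[x₁,x₂,x₃] at the origin. Let P = X₂ + P* and Q = X₃ + Q* where P*, Q* ∈ m₀². Then for every natural number s, (X₂, X₃) ∩ m₀^s ⊆ ((P,Q) ∩ m₀^s) + m₀^{s+1}; that is, for every R ∈ (X₂,X₃) with R ∈ m₀^s there exist polynomials R₂, R₃ and R'' ∈ m₀^{s+1} with R = R₂·P + R₃·Q + R'' and R₂·P + R₃·Q ∈ m₀^s. -/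
open MvPolynomial

/-- An element of the ideal generated by a set `S` of variables that vanishes to order `n` at the
origin is a combination of the variables in `S` with coefficients vanishing to order `n - 1`. -/
theorem span_X_image_inf_pow_idealOfVars_le {σ A : Type*} [CommSemiring A] (S : Set σ) (n : ℕ) :
    Ideal.span (X '' S) ⊓ idealOfVars σ A ^ n ≤
      Ideal.span (X '' S) * idealOfVars σ A ^ (n - 1) := by
  rintro p ⟨hpS, hpn⟩
  rw [p.as_sum]
  refine Ideal.sum_mem _ fun e he => ?_
  obtain ⟨i, hiS, hi⟩ := mem_ideal_span_X_image.mp hpS e he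
  have hle : Finsupp.single i 1 ≤ e := by
    simpa [Nat.one_le_iff_ne_zero] using hi
  obtain ⟨d, rfl⟩ := exists_add_of_le hle
  have hdeg := (mem_pow_idealOfVars_iff n p).mp hpn _ he
  have hd : n - 1 ≤ d.degree := by
    rw [map_add, Finsupp.degree_single] at hdeg
    omega
  rw [← one_mul (coeff _ p), ← monomial_mul]
  exact Ideal.mul_mem_mul (Ideal.subset_span (Set.mem_image_of_mem X hiS))
    ((monomial_mem_pow_idealOfVars_iff _ _ (mem_support_iff.mp he)).mpr hd)

/-- Lemma `(P,Q)` vs `(x₂,x₃)` modulo higher order.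
Let `m₀ = (X₁,X₂,X₃)` be the maximal ideal at the origin, `P = X₂ + P*`, `Q = X₃ + Q*`
with `P*, Q* ∈ m₀²`.  Then for every `s`, every `R ∈ (X₂,X₃) ∩ m₀^s` can be written
`R = R₂·P + R₃·Q + R''` with `R'' ∈ m₀^{s+1}` and `R₂·P + R₃·Q ∈ m₀^s`; that is,
`(X₂,X₃) ∩ m₀^s ⊆ ((P,Q) ∩ m₀^s) + m₀^{s+1}`. -/
theorem statement3 {K : Type*} [Field K]
    (Pstar Qstar : MvPolynomial (Fin 3) K)
    (hP : Pstar ∈ (Ideal.span {X 0, X 1, X 2} : Ideal (MvPolynomial (Fin 3) K)) ^ 2)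
    (hQ : Qstar ∈ (Ideal.span {X 0, X 1, X 2} : Ideal (MvPolynomial (Fin 3) K)) ^ 2)
    (s : ℕ) (R : MvPolynomial (Fin 3) K)
    (hR1 : R ∈ (Ideal.span {X 1, X 2} : Ideal (MvPolynomial (Fin 3) K)))
    (hR2 : R ∈ (Ideal.span {X 0, X 1, X 2} : Ideal (MvPolynomial (Fin 3) K)) ^ s) :
    ∃ R₂ R₃ R'' : MvPolynomial (Fin 3) K,
      R'' ∈ (Ideal.span {X 0, X 1, X 2} : Ideal (MvPolynomial (Fin 3) K)) ^ (s + 1) ∧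
      R = R₂ * (X 1 + Pstar) + R₃ * (X 2 + Qstar) + R'' ∧
      R₂ * (X 1 + Pstar) + R₃ * (X 2 + Qstar) ∈
        (Ideal.span {X 0, X 1, X 2} : Ideal (MvPolynomial (Fin 3) K)) ^ s := by
  have hm : (Ideal.span {X 0, X 1, X 2} : Ideal (MvPolynomial (Fin 3) K)) =
      idealOfVars (Fin 3) K := by
    congr 1
    ext p
    simp [Fin.exists_fin_succ, eq_comm]
  have hS : ({X 1, X 2} : Set (MvPolynomial (Fin 3) K)) = X '' {1, 2} := by
    rw [Set.image_pair]
  rw [hm] at hP hQ hR2 ⊢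
  have hR : R ∈ Ideal.span {X 1, X 2} * idealOfVars (Fin 3) K ^ (s - 1) := by
    rw [hS] at hR1 ⊢
    exact span_X_image_inf_pow_idealOfVars_le _ s ⟨hR1, hR2⟩
  rw [Ideal.span_insert, Ideal.sup_mul] at hR
  obtain ⟨_, hA', _, hB', rfl⟩ := Submodule.mem_sup.mp hR
  obtain ⟨A, hA, rfl⟩ := Ideal.mem_span_singleton_mul.mp hA'
  obtain ⟨B, hB, rfl⟩ := Ideal.mem_span_singleton_mul.mp hB'
  have hrem : A * Pstar + B * Qstar ∈ idealOfVars (Fin 3) K ^ (s + 1) := by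
    refine Ideal.pow_le_pow_right (by omega : s + 1 ≤ s - 1 + 2) ?_
    rw [pow_add]
    exact add_mem (Ideal.mul_mem_mul hA hP) (Ideal.mul_mem_mul hB hQ)
  refine ⟨A, B, -(A * Pstar + B * Qstar), neg_mem hrem, by ring, ?_⟩
  convert add_mem hR2 (Ideal.pow_le_pow_right s.le_succ hrem) using 1
  ring
end

section
/- Let K be a field and let m₀ = (X₁, X₂, X₃) be the maximal ideal of K[x₁,x₂,x₃] at the origin. Let P = X₂ + P* and Q = X₃ + Q* where P*, Q* ∈ m₀². Then for every natural number r, the quotient ring K[x₁,x₂,x₃]/((P,Q) + m₀^{r+1}) has dimension at most r+1 as a K-vector space. -/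
open MvPolynomial

/-- If `A = K + aA` and `a ^ n = 0`, then `A` is spanned over `K` by `1, a, …, a ^ (n - 1)`. -/
theorem rank_le_of_pow_eq_zero {K A : Type*} [Field K] [CommRing A] [Algebra K A] (a : A)
    (h : ∀ y : A, ∃ (c : K) (g : A), y = algebraMap K A c + a * g) (n : ℕ) (hn : a ^ n = 0) :
    Module.rank K A ≤ n := by
  classical
  set s : Finset A := (Finset.range n).image (a ^ ·) with hs
  have key : ∀ k ≤ n, ∀ y : A, ∃ q ∈ Submodule.span K (s : Set A), ∃ g, y = q + a ^ k * g := by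
    intro k
    induction k with
    | zero => exact fun _ y => ⟨0, zero_mem _, y, by simp⟩
    | succ k ih =>
      intro hk y
      obtain ⟨q, hq, g, rfl⟩ := ih (by omega) y
      obtain ⟨c, g', rfl⟩ := h g
      refine ⟨q + c • a ^ k, add_mem hq (Submodule.smul_mem _ _ (Submodule.subset_span ?_)), g', ?_⟩
      · exact Finset.mem_coe.2 (Finset.mem_image.2 ⟨k, Finset.mem_range.2 (by omega), rfl⟩)
      · rw [Algebra.smul_def]
        ring
  have htop : Submodule.span K (s : Set A) = ⊤ := by
    refine eq_top_iff.2 fun y _ => ?_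
    obtain ⟨q, hq, g, rfl⟩ := key n le_rfl y
    simpa [hn] using hq
  rw [← rank_top, ← htop]
  refine (rank_span_finset_le s).trans ?_
  exact_mod_cast Finset.card_image_le.trans (Finset.card_range n).le

/-- A form of Nakayama's lemma modulo a power of `m`. -/
theorem Ideal.le_of_le_sup_sq_of_pow_le {R : Type*} [CommRing R] {m T : Ideal R}
    (h : m ≤ T ⊔ m ^ 2) {n : ℕ} (hn : m ^ (n + 1) ≤ T) : m ≤ T := by
  have key : ∀ k : ℕ, m ≤ T ⊔ m ^ (k + 1) := by
    intro k
    induction k with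
    | zero => simp
    | succ k ih =>
      refine ih.trans (sup_le le_sup_left ?_)
      calc m ^ (k + 1) = m ^ k * m := pow_succ _ _
        _ ≤ m ^ k * (T ⊔ m ^ 2) := Ideal.mul_mono_right h
        _ = m ^ k * T ⊔ m ^ (k + 2) := by rw [Ideal.mul_sup, pow_add]
        _ ≤ T ⊔ m ^ (k + 1 + 1) := sup_le_sup_right Ideal.mul_le_right _
  exact (key n).trans (sup_le le_rfl hn)

/-- A polynomial minus its constant term lies in any ideal containing the variables. -/
theorem MvPolynomial.sub_C_constantCoeff_mem {K σ : Type*} [CommRing K]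
    {I : Ideal (MvPolynomial σ K)} (hI : ∀ i, X i ∈ I) (p : MvPolynomial σ K) :
    p - C (constantCoeff p) ∈ I := by
  induction p using MvPolynomial.induction_on with
  | C a => simp
  | add p q hp hq =>
    have := add_mem hp hq
    rwa [← add_sub_add_comm, ← C_add, ← map_add] at this
  | mul_X p i hp => simpa using I.mul_mem_left p (hI i)

/-- dimension bound for the quotient.
Let `m₀ = (X₁,X₂,X₃)`, `P = X₂ + P*`, `Q = X₃ + Q*` with `P*, Q* ∈ m₀²`.  Then for every
`r`, the quotient `K[x₁,x₂,x₃]/((P,Q) + m₀^{r+1})` has dimension at most `r+1` as a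
`K`-vector space. -/
theorem statement4 {K : Type*} [Field K]
    (Pstar Qstar : MvPolynomial (Fin 3) K)
    (hP : Pstar ∈ (Ideal.span {X 0, X 1, X 2} : Ideal (MvPolynomial (Fin 3) K)) ^ 2)
    (hQ : Qstar ∈ (Ideal.span {X 0, X 1, X 2} : Ideal (MvPolynomial (Fin 3) K)) ^ 2)
    (r : ℕ) :
    Module.rank K (MvPolynomial (Fin 3) K ⧸
        (Ideal.span {X 1 + Pstar, X 2 + Qstar} +
          (Ideal.span {X 0, X 1, X 2} : Ideal (MvPolynomial (Fin 3) K)) ^ (r + 1))) ≤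
      r + 1 := by
  set m : Ideal (MvPolynomial (Fin 3) K) := Ideal.span {X 0, X 1, X 2} with hm
  set I : Ideal (MvPolynomial (Fin 3) K) :=
    Ideal.span {X 1 + Pstar, X 2 + Qstar} + m ^ (r + 1) with hI
  have hX : ∀ i, (X i : MvPolynomial (Fin 3) K) ∈ m := by
    intro i
    apply Ideal.subset_span
    fin_cases i <;> simp
  have hmI : m ^ (r + 1) ≤ I := le_sup_right
  have hPI : X 1 + Pstar ∈ I := Ideal.mem_sup_left (Ideal.subset_span (by simp))
  have hQI : X 2 + Qstar ∈ I := Ideal.mem_sup_left (Ideal.subset_span (by simp))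
  have hmT : m ≤ Ideal.span {X 0} ⊔ I := by
    refine Ideal.le_of_le_sup_sq_of_pow_le ?_ (hmI.trans le_sup_right)
    rw [hm, Ideal.span_le, ← hm]
    rintro _ (rfl | rfl | rfl)
    · exact Ideal.mem_sup_left (Ideal.mem_sup_left (Ideal.mem_span_singleton_self _))
    · rw [← add_sub_cancel_right (X 1) Pstar]
      exact sub_mem (Ideal.mem_sup_left (Ideal.mem_sup_right hPI)) (Ideal.mem_sup_right hP)
    · rw [← add_sub_cancel_right (X 2) Qstar]
      exact sub_mem (Ideal.mem_sup_left (Ideal.mem_sup_right hQI)) (Ideal.mem_sup_right hQ)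
  have hrank := rank_le_of_pow_eq_zero (K := K) (Ideal.Quotient.mk I (X 0)) (fun y => ?_) (r + 1) ?_
  · exact_mod_cast hrank
  · obtain ⟨p, rfl⟩ := Ideal.Quotient.mk_surjective y
    obtain ⟨u, hu, v, hv, huv⟩ := Submodule.mem_sup.1 (hmT (sub_C_constantCoeff_mem hX p))
    obtain ⟨g, rfl⟩ := Ideal.mem_span_singleton'.1 hu
    refine ⟨constantCoeff p, Ideal.Quotient.mk I g, ?_⟩
    have hp : p = C (constantCoeff p) + X 0 * g + v := by linear_combination -huv
    change _ = Ideal.Quotient.mk I (C (constantCoeff p)) + _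
    rw [← map_mul, ← map_add, Ideal.Quotient.eq]
    rwa [sub_eq_of_eq_add' hp]
  · rw [← map_pow, Ideal.Quotient.eq_zero_iff_mem]
    exact hmI (Ideal.pow_mem_pow (hX 0) _)
end

section
/- Let N ≥ 0 and let τ : ℕ → ℕ be a function. Then there exists a number M₀ (depending only on N and τ) with the following property: for every sequence ℓ₁, ℓ₂, ℓ₃, … of (N+1)-tuples of natural numbers (ℓᵢ : Fin (N+1) → ℕ) that is weakly monotonically decreasing in the reverse lexicographic order (for each i, either ℓ_{i+1} = ℓᵢ or ℓ_{i+1} ≺ ℓᵢ) and satisfies |ℓᵢ| ≤ τ(i) for every i, there exists r₀ with 2 ≤ r₀ ≤ M₀ such that ℓ_{r₀−1} = ℓ_{r₀}. -/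
/-- The reverse lexicographic order on tuples of natural numbers: `a ≺ b` iff at the
largest index where they differ, the entry of `a` is smaller; equivalently, there is an
index `k` with `a k < b k` and `a m = b m` for all `m > k`. -/
def RevLexLt {n : ℕ} (a b : Fin n → ℕ) : Prop :=
  ∃ k : Fin n, a k < b k ∧ ∀ m : Fin n, k < m → a m = b m

theorem wellFounded_revLexLt (n : ℕ) : WellFounded (RevLexLt (n := n)) := by
  have h : WellFounded (Pi.Lex (fun i j : Fin n => j < i)
      (fun {_ : Fin n} (a b : ℕ) => a < b)) :=
    Pi.Lex.wellFounded _ fun _ => wellFounded_lt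
  exact Subrelation.wf (fun {a b} ⟨k, hk, hm⟩ => ⟨k, hm, hk⟩) h

theorem finite_setOf_sum_le (n t : ℕ) : {a : Fin n → ℕ | ∑ k, a k ≤ t}.Finite :=
  (Set.finite_Iic (fun _ : Fin n => t)).subset fun a ha k =>
    (Finset.single_le_sum (f := a) (fun _ _ => Nat.zero_le _) (Finset.mem_univ k)).trans ha

theorem exists_bound_repetition_of_initial {n : ℕ} (τ : ℕ → ℕ) (a : Fin n → ℕ) :
    ∀ i : ℕ, ∃ M : ℕ, ∀ ℓ : ℕ → (Fin n → ℕ), ℓ i = a →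
      (∀ j, i ≤ j → (ℓ (j + 1) = ℓ j ∨ RevLexLt (ℓ (j + 1)) (ℓ j))) →
      (∀ j, i ≤ j → ∑ k, ℓ j k ≤ τ j) →
      ∃ r, i < r ∧ r ≤ M ∧ ℓ (r - 1) = ℓ r := by
  induction a using (wellFounded_revLexLt n).induction with
  | _ a ih =>
    intro i
    choose! f hf using fun b hb => ih b hb (i + 1)
    obtain ⟨B, hB⟩ := ((finite_setOf_sum_le n (τ (i + 1))).image f).bddAbove
    refine ⟨max (i + 1) B, fun ℓ ha hstep hsum => ?_⟩
    rcases hstep i le_rfl with h | h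
    · exact ⟨i + 1, i.lt_succ_self, le_max_left _ _, h.symm⟩
    · obtain ⟨r, hr, hrM, heq⟩ := hf (ℓ (i + 1)) (ha ▸ h) ℓ rfl
        (fun j hj => hstep j (by omega)) (fun j hj => hsum j (by omega))
      have hle := hB (Set.mem_image_of_mem f (hsum (i + 1) (by omega)))
      exact ⟨r, by omega, (hrM.trans hle).trans (le_max_right _ _), heq⟩


/-- length of decreasing chains of tuples.
For every `N` and `τ : ℕ → ℕ` there is `M₀` such that: every sequence `ℓ₁, ℓ₂, …` of
`(N+1)`-tuples of naturals that is weakly decreasing in the reverse lexicographic order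
and satisfies `|ℓᵢ| ≤ τ(i)` has some `2 ≤ r₀ ≤ M₀` with `ℓ_{r₀−1} = ℓ_{r₀}`. -/
theorem statement14 (N : ℕ) (τ : ℕ → ℕ) :
    ∃ M₀ : ℕ, ∀ ℓ : ℕ → (Fin (N + 1) → ℕ),
      (∀ i, 1 ≤ i → (ℓ (i + 1) = ℓ i ∨ RevLexLt (ℓ (i + 1)) (ℓ i))) →
      (∀ i, 1 ≤ i → ∑ k, ℓ i k ≤ τ i) →
      ∃ r₀, 2 ≤ r₀ ∧ r₀ ≤ M₀ ∧ ℓ (r₀ - 1) = ℓ r₀ := by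
  choose f hf using fun a : Fin (N + 1) → ℕ => exists_bound_repetition_of_initial τ a 1
  obtain ⟨B, hB⟩ := ((finite_setOf_sum_le (N + 1) (τ 1)).image f).bddAbove
  refine ⟨B, fun ℓ hstep hsum => ?_⟩
  obtain ⟨r, hr, hrM, heq⟩ := hf (ℓ 1) ℓ rfl hstep hsum
  exact ⟨r, hr, hrM.trans (hB (Set.mem_image_of_mem f (hsum 1 le_rfl))), heq⟩
end

section
/- Let K̃ be a field, let N ≥ 0, and let τ : ℕ → ℕ be a function. Then there exists a number M₀ with the following property: for every sequence of ideals I₁, I₂, I₃, … of K̃[y₁,…,y_N] such that each Iᵢ has complexity at most τ(i) (i.e., Iᵢ admits a finite generating set f₁,…,f_ℓ with deg f₁ + ⋯ + deg f_ℓ ≤ τ(i), degrees being total degrees), there exists r₀ with 2 ≤ r₀ ≤ M₀ such that I_{r₀} ⊆ I₁ + I₂ + ⋯ + I_{r₀−1} (the ideal sum, i.e., supremum, of the earlier ideals). -/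
/-- A polynomial outside an ideal `J` that has minimal degree among the elements of `K \ J`, where
`J ≤ K`, has a leading monomial not divisible by the leading monomial of a nonzero element of
`J`. -/
theorem MonomialOrder.exists_mem_not_mem_forall_not_degree_le {σ F : Type*} [Field F]
    (m : MonomialOrder σ) {J K : Ideal (MvPolynomial σ F)} (hJK : J ≤ K)
    {f : MvPolynomial σ F} (hfK : f ∈ K) (hfJ : f ∉ J) :
    ∃ g ∈ K, g ∉ J ∧ m.toSyn (m.degree g) ≤ m.toSyn (m.degree f) ∧
      ∀ h ∈ J, h ≠ 0 → ¬ m.degree h ≤ m.degree g := by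
  obtain ⟨g, ⟨hgK, hgJ⟩, hmin⟩ := exists_minimalFor_of_wellFoundedLT
    (fun g => g ∈ K ∧ g ∉ J) (fun g => m.toSyn (m.degree g)) ⟨f, hfK, hfJ⟩
  replace hmin (p) (hK : p ∈ K) (hJ : p ∉ J) := le_of_not_gt fun hlt =>
    (hmin ⟨hK, hJ⟩ hlt.le).not_gt hlt
  refine ⟨g, hgK, hgJ, hmin f hfK hfJ, fun h hh h0 hle => ?_⟩
  have hu : IsUnit (m.leadingCoeff h) := by simpa using h0
  by_cases hg : m.degree g = 0
  · have h1 : m.degree h = 0 := by simpa [hg] using hle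
    have h2 : h = MvPolynomial.C (m.leadingCoeff h) := m.degree_eq_zero_iff.1 h1
    have h3 : IsUnit h := by
      rw [h2]
      exact hu.map MvPolynomial.C
    exact hgJ (Ideal.eq_top_of_isUnit_mem J hh h3 ▸ Submodule.mem_top)
  · have hred : ∀ c, c * h ∈ J := fun c => J.mul_mem_left c hh
    refine (m.degree_reduce_lt hu hle hg).not_ge (hmin _ ?_ fun hr => hgJ ?_)
    · exact K.sub_mem hgK (hJK (hred _))
    · exact (J.sub_mem_iff_left (hred _)).1 hr

/-- **Dickson's lemma**, quantitatively: sequences of monomials with prescribed bounds on the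
degrees contain a divisibility within a uniformly bounded initial segment. -/
theorem Finsupp.exists_bound_exists_lt_le {σ : Type*} [Finite σ] (τ : ℕ → ℕ) :
    ∃ M : ℕ, ∀ a : ℕ → σ →₀ ℕ, (∀ i, (a i).degree ≤ τ i) → ∃ i j, i < j ∧ j < M ∧ a i ≤ a j := by
  let X (i : ℕ) := {d : σ →₀ ℕ // d.degree ≤ τ i}
  let _ (i : ℕ) : TopologicalSpace (X i) := ⊥
  have _ (i : ℕ) : DiscreteTopology (X i) := ⟨rfl⟩
  have _ (i : ℕ) : Finite (X i) := (Finsupp.finite_of_degree_le (τ i)).to_subtype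
  let U (M : ℕ) : Set (∀ i, X i) := {x | ∃ i j, i < j ∧ j < M ∧ (x i).1 ≤ (x j).1}
  have hU (M : ℕ) : IsOpen (U M) := by
    have : U M = ⋃ (i : ℕ) (j : ℕ) (_ : i < j ∧ j < M),
        (fun x : ∀ i, X i => (x i, x j)) ⁻¹' {p | p.1.1 ≤ p.2.1} := by
      ext x
      simp [U, and_assoc]
    rw [this]
    refine isOpen_iUnion fun i => isOpen_iUnion fun j => isOpen_iUnion fun _ => ?_
    exact (isOpen_discrete _).preimage (by fun_prop)
  have hmono : Monotone U := fun M M' h x ⟨i, j, hij, hj, hle⟩ =>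
    ⟨i, j, hij, hj.trans_le h, hle⟩
  have hcover : Set.univ ⊆ ⋃ M, U M := fun x _ => by
    obtain ⟨i, j, hij, hle⟩ := wellQuasiOrdered_le fun i => (x i).1
    exact Set.mem_iUnion.2 ⟨j + 1, i, j, hij, j.lt_succ_self, hle⟩
  obtain ⟨M, hM⟩ := isCompact_univ.elim_directed_cover U hU hcover hmono.directed_le
  exact ⟨M, fun a ha => hM (Set.mem_univ fun i => (⟨a i, ha i⟩ : X i))⟩


/-- quantitative ascending chain condition for ideals.
For every field `K̃`, every `N`, and every `τ : ℕ → ℕ` there is `M₀` such that: for every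
sequence of ideals `I₁, I₂, …` of `K̃[y₁,…,y_N]` in which `Iᵢ` has a finite generating set
whose total degrees sum to at most `τ(i)`, there is `2 ≤ r₀ ≤ M₀` with
`I_{r₀} ⊆ I₁ + ⋯ + I_{r₀−1}`. -/
theorem statement15 (F : Type*) [Field F] (N : ℕ) (τ : ℕ → ℕ) :
    ∃ M₀ : ℕ, ∀ I : ℕ → Ideal (MvPolynomial (Fin N) F),
      (∀ i, 1 ≤ i → ∃ l : List (MvPolynomial (Fin N) F),
          Ideal.span {f | f ∈ l} = I i ∧ (l.map MvPolynomial.totalDegree).sum ≤ τ i) →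
      ∃ r₀, 2 ≤ r₀ ∧ r₀ ≤ M₀ ∧ I r₀ ≤ ∑ i ∈ Finset.Ico 1 r₀, I i := by
  obtain ⟨M, hM⟩ := Finsupp.exists_bound_exists_lt_le (σ := Fin N) fun i => τ (i + 2)
  refine ⟨M + 2, fun I hI => ?_⟩
  by_contra! hbad
  let m : MonomialOrder (Fin N) := MonomialOrder.degLex
  let J (r : ℕ) : Ideal (MvPolynomial (Fin N) F) := ∑ i ∈ Finset.Ico 1 r, I i
  have hJ : Monotone J := fun r s hrs => by
    simp only [J, Ideal.sum_eq_sup]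
    exact Finset.sup_mono (Finset.Ico_subset_Ico_right hrs)
  have hIJ (r : ℕ) (hr : 1 ≤ r) : I r ≤ J (r + 1) := by
    simp only [J, Ideal.sum_eq_sup]
    exact Finset.le_sup (f := I) (Finset.mem_Ico.2 ⟨hr, r.lt_succ_self⟩)
  have key (i : ℕ) : ∃ a : Fin N →₀ ℕ, a.degree ≤ τ (i + 2) ∧ (i < M →
      ∃ g ∈ J (i + 3), g ≠ 0 ∧ m.degree g = a ∧ ∀ h ∈ J (i + 2), h ≠ 0 → ¬ m.degree h ≤ a) := by
    by_cases hi : i < M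
    · obtain ⟨l, hl, hdeg⟩ := hI (i + 2) (by omega)
      have hnle : ¬ I (i + 2) ≤ J (i + 2) := hbad (i + 2) (by omega) (by omega)
      rw [← hl, Ideal.span_le, Set.not_subset] at hnle
      obtain ⟨f, hf, hfJ⟩ := hnle
      have hfI : f ∈ I (i + 2) := hl ▸ Ideal.subset_span hf
      have hfdeg : f.totalDegree ≤ τ (i + 2) :=
        (List.le_sum_of_mem (List.mem_map_of_mem hf)).trans hdeg
      obtain ⟨g, hgK, hgJ, hgf, hg⟩ := m.exists_mem_not_mem_forall_not_degree_le
        (hJ (Nat.le_succ (i + 2))) (hIJ (i + 2) (by omega) hfI) hfJ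
      refine ⟨m.degree g, ?_, fun _ => ⟨g, hgK, fun h0 => hgJ (h0 ▸ zero_mem _), rfl, hg⟩⟩
      rw [MvPolynomial.degree_degLexDegree]
      exact (MvPolynomial.degLex_totalDegree_monotone hgf).trans hfdeg
    · exact ⟨0, by simp, fun h => absurd h hi⟩
  choose a ha hga using key
  obtain ⟨i, j, hij, hjM, hle⟩ := hM a ha
  obtain ⟨g, hgJ, hg0, hgi, -⟩ := hga i (hij.trans hjM)
  obtain ⟨-, -, -, -, hj⟩ := hga j hjM
  exact hj g (hJ (by omega) hgJ) hg0 (hgi ▸ hle)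
end

section
/- Let K̃ be a field, let N ≥ 0, and let τ : ℕ → ℕ be a function. Then there exists a number M₀ with the following property: for every sequence of polynomials f₁, f₂, f₃, … in K̃[y₁,…,y_N] with deg fᵢ ≤ τ(i) for every i (total degrees), there exists r₀ with 2 ≤ r₀ ≤ M₀ such that f_{r₀} lies in the ideal generated by f₁, …, f_{r₀−1}. -/
/-- A family of polynomials of uniformly bounded degree in finitely many variables is the family of
specializations of a single polynomial over the product ring. -/
theorem MvPolynomial.exists_map_evalRingHom_eq {σ ι R : Type*} [Finite σ] [CommRing R] (d : ℕ)
    (g : ι → MvPolynomial σ R) (hg : ∀ i, (g i).totalDegree ≤ d) :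
    ∃ G : MvPolynomial σ (ι → R),
      ∀ i, MvPolynomial.map (Pi.evalRingHom (fun _ : ι => R) i) G = g i := by
  classical
  have hfin : {m : σ →₀ ℕ | m.degree ≤ d}.Finite := Finsupp.finite_of_degree_le d
  refine ⟨∑ m ∈ hfin.toFinset, MvPolynomial.monomial m fun i => (g i).coeff m, fun i => ?_⟩
  rw [map_sum]
  simp only [MvPolynomial.map_monomial, Pi.evalRingHom_apply]
  conv_rhs => rw [(g i).as_sum]
  symm
  refine Finset.sum_subset (fun m hm => ?_) (fun m _ hm => ?_)
  · refine hfin.mem_toFinset.mpr ?_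
    exact (MvPolynomial.le_totalDegree hm).trans (hg i)
  · rw [MvPolynomial.notMem_support_iff.mp hm, map_zero]

/-- If the images of two polynomials over a product ring agree over the ring of germs along a
filter, then their specializations agree eventually along that filter. -/
theorem MvPolynomial.eventually_map_evalRingHom_eq {σ ι R : Type*} [CommRing R] {l : Filter ι}
    {p q : MvPolynomial σ (ι → R)}
    (h : MvPolynomial.map (Filter.Germ.coeRingHom l) p =
      MvPolynomial.map (Filter.Germ.coeRingHom l) q) :
    ∀ᶠ i in l, MvPolynomial.map (Pi.evalRingHom (fun _ : ι => R) i) p =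
      MvPolynomial.map (Pi.evalRingHom (fun _ : ι => R) i) q := by
  classical
  have hcoeff : ∀ m, ∀ᶠ i in l, p.coeff m i = q.coeff m i := fun m => by
    have hm := congrArg (MvPolynomial.coeff m) h
    rw [MvPolynomial.coeff_map, MvPolynomial.coeff_map] at hm
    exact Filter.Germ.coe_eq.mp hm
  have hall : ∀ᶠ i in l, ∀ m ∈ p.support ∪ q.support, p.coeff m i = q.coeff m i :=
    (Filter.eventually_all_finset _).mpr fun m _ => hcoeff m
  filter_upwards [hall] with i hi
  ext m
  rw [MvPolynomial.coeff_map, MvPolynomial.coeff_map]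
  by_cases hm : m ∈ p.support ∪ q.support
  · exact hi m hm
  · rw [Finset.notMem_union, MvPolynomial.notMem_support_iff,
      MvPolynomial.notMem_support_iff] at hm
    rw [hm.1, hm.2]

/-- quantitative ascending chain condition for polynomials.
For every field `K̃`, every `N`, and every `τ : ℕ → ℕ` there is `M₀` such that: for every
sequence of polynomials `f₁, f₂, …` in `K̃[y₁,…,y_N]` with `deg fᵢ ≤ τ(i)`, there is
`2 ≤ r₀ ≤ M₀` such that `f_{r₀}` lies in the ideal generated by `f₁, …, f_{r₀−1}`. -/
theorem statement16 (F : Type*) [Field F] (N : ℕ) (τ : ℕ → ℕ) :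
    ∃ M₀ : ℕ, ∀ f : ℕ → MvPolynomial (Fin N) F,
      (∀ i, 1 ≤ i → (f i).totalDegree ≤ τ i) →
      ∃ r₀, 2 ≤ r₀ ∧ r₀ ≤ M₀ ∧
        f r₀ ∈ Ideal.span {g : MvPolynomial (Fin N) F | ∃ i, 1 ≤ i ∧ i < r₀ ∧ g = f i} := by
  by_contra! hcon
  choose f hdeg hbad using hcon
  let φ : Ultrafilter ℕ := Filter.hyperfilter ℕ
  -- Glue the bad sequences, one for each bound, into one sequence over the product ring.
  have hlift : ∀ i, ∃ G : MvPolynomial (Fin N) (ℕ → F), 1 ≤ i →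
      ∀ M, MvPolynomial.map (Pi.evalRingHom (fun _ : ℕ => F) M) G = f M i := by
    intro i
    by_cases hi : 1 ≤ i
    · obtain ⟨G, hG⟩ := MvPolynomial.exists_map_evalRingHom_eq (τ i) (fun M => f M i)
        fun M => hdeg M i hi
      exact ⟨G, fun _ => hG⟩
    · exact ⟨0, fun h => absurd h hi⟩
  choose G hG using hlift
  let I : ℕ → Ideal (MvPolynomial (Fin N) (ℕ → F)) :=
    fun r => Ideal.span {g | ∃ i, 1 ≤ i ∧ i < r ∧ g = G i}
  have hI : Monotone I := fun r s hrs => Ideal.span_mono <| by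
    rintro g ⟨i, hi, hir, rfl⟩
    exact ⟨i, hi, hir.trans_le hrs, rfl⟩
  let q := MvPolynomial.map (σ := Fin N) (Filter.Germ.coeRingHom (R := F) (φ : Filter ℕ))
  have hq : Function.Surjective q := MvPolynomial.map_surjective _ Quot.mk_surjective
  -- The ideals stabilize over the ultrapower of `F`, which is a field.
  obtain ⟨n, hn⟩ := monotone_stabilizes_iff_noetherian.mpr
    (inferInstance : IsNoetherianRing (MvPolynomial (Fin N) (Filter.Germ (φ : Filter ℕ) F)))
    ⟨fun r => (I r).map q, fun r s hrs => Ideal.map_mono (hI hrs)⟩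
  have hmem : q (G (n + 2)) ∈ (I (n + 2)).map q := by
    have h₁ : (I n).map q = (I (n + 2)).map q := hn (n + 2) (by lia)
    have h₂ : (I n).map q = (I (n + 3)).map q := hn (n + 3) (by lia)
    rw [← h₁, h₂]
    exact Ideal.mem_map_of_mem q (Ideal.subset_span ⟨n + 2, by lia, by lia, rfl⟩)
  obtain ⟨p, hp, hpq⟩ := (Ideal.mem_map_iff_of_surjective q hq).mp hmem
  have hlarge : ∀ᶠ M in (φ : Filter ℕ), n + 2 ≤ M :=
    Nat.hyperfilter_le_atTop (Filter.eventually_ge_atTop (n + 2))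
  obtain ⟨M, hM, hle⟩ := ((MvPolynomial.eventually_map_evalRingHom_eq hpq).and hlarge).exists
  refine hbad M (n + 2) (by lia) hle ?_
  rw [← hG (n + 2) (by lia) M, ← hM]
  refine Ideal.mem_comap.mp ((Ideal.span_le.mpr ?_ : I (n + 2) ≤ Ideal.comap _ _) hp)
  rintro g ⟨i, hi, hir, rfl⟩
  exact Ideal.subset_span ⟨i, hi, hir, hG i hi M⟩
end

section
/- Let K be a field, let X ⊆ K³ be a finite set of points, and let D be a natural number with D³ ≥ 6·|X|. Then there exists a nonzero polynomial P ∈ K[x₁,x₂,x₃] of total degree at most D that vanishes at every point of X. (In particular, there is a nonzero polynomial of degree at most 3·|X|^{1/3} vanishing on X; this is the interpolation estimate used in the paper, based on the fact that the space of polynomials of degree ≤ D has dimension (D+1)(D+2)(D+3)/6 > D³/6.) -/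
open MvPolynomial

/-- A space of polynomials spanned by more than `|X|` monomials contains a nonzero polynomial
vanishing on `X`. -/
theorem exists_mem_restrictSupport_eval_eq_zero {σ K : Type*} [Field K] (X : Finset (σ → K))
    (S : Finset (σ →₀ ℕ)) (h : X.card < S.card) :
    ∃ P ∈ restrictSupport K (S : Set (σ →₀ ℕ)), P ≠ 0 ∧ ∀ x ∈ X, eval x P = 0 := by
  let b := basisRestrictSupport K (S : Set (σ →₀ ℕ))
  have : Module.Finite K (restrictSupport K (S : Set (σ →₀ ℕ))) := Module.Finite.of_basis b
  let evalOn : restrictSupport K (S : Set (σ →₀ ℕ)) →ₗ[K] X → K :=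
    LinearMap.pi fun x ↦ (aeval (R := K) x.1).toLinearMap ∘ₗ Submodule.subtype _
  have hker : LinearMap.ker evalOn ≠ ⊥ := evalOn.ker_ne_bot_of_finrank_lt <| by
    simpa [Module.finrank_eq_card_basis b] using h
  obtain ⟨P, hP, hP0⟩ := Submodule.exists_mem_ne_zero_of_ne_bot hker
  refine ⟨P, P.2, by simpa using hP0, fun x hx ↦ ?_⟩
  simpa [evalOn, aeval_eq_eval] using congrFun (LinearMap.mem_ker.mp hP) ⟨x, hx⟩

/-- The number of monomials of degree at most `D` in the variables indexed by `σ`. -/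
theorem card_biUnion_finsuppAntidiag_univ (σ : Type*) [Fintype σ] [DecidableEq σ] (D : ℕ) :
    ((Finset.range (D + 1)).biUnion fun n ↦ (Finset.univ : Finset σ).finsuppAntidiag n).card =
      (D + Fintype.card σ).choose (Fintype.card σ) := by
  rw [Finset.card_biUnion]
  · simp [Finset.card_finsuppAntidiag_nat_eq_multichoose, Nat.sum_range_multichoose]
  · intro m _ n _ hmn
    refine Finset.disjoint_left.mpr ?_
    intro f hm hn
    rw [Finset.mem_finsuppAntidiag] at hm hn
    exact hmn (hm.1.symm.trans hn.1)

/-- If there are more than `|X|` monomials of degree at most `D`, then some nonzero polynomial of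
total degree at most `D` vanishes on `X`. -/
theorem exists_totalDegree_le_eval_eq_zero {σ K : Type*} [Fintype σ] [Field K]
    (X : Finset (σ → K)) (D : ℕ) (h : X.card < (D + Fintype.card σ).choose (Fintype.card σ)) :
    ∃ P : MvPolynomial σ K, P ≠ 0 ∧ P.totalDegree ≤ D ∧ ∀ x ∈ X, eval x P = 0 := by
  classical
  rw [← card_biUnion_finsuppAntidiag_univ] at h
  obtain ⟨P, hPS, hP0, hPX⟩ := exists_mem_restrictSupport_eval_eq_zero X _ h
  refine ⟨P, hP0, Finset.sup_le fun m hm ↦ ?_, hPX⟩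
  obtain ⟨n, hn, hmn⟩ := Finset.mem_biUnion.mp (hPS hm)
  rw [Finset.mem_range] at hn
  rw [Finset.mem_finsuppAntidiag] at hmn
  rw [Finsupp.sum_fintype _ _ fun _ ↦ rfl, hmn.1]
  omega

/-- polynomial interpolation.
If `X ⊆ K³` is a finite set of points and `D³ ≥ 6·|X|`, then there is a nonzero polynomial
`P ∈ K[x₁,x₂,x₃]` of total degree at most `D` vanishing at every point of `X`. -/
theorem statement19 {K : Type*} [Field K] (X : Finset (Fin 3 → K)) (D : ℕ)
    (hD : 6 * X.card ≤ D ^ 3) :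
    ∃ P : MvPolynomial (Fin 3) K, P ≠ 0 ∧ P.totalDegree ≤ D ∧
      ∀ x ∈ X, eval x P = 0 := by
  refine exists_totalDegree_le_eval_eq_zero X D ?_
  rw [Fintype.card_fin]
  have hchoose : (D + 1) * (D + 2) * (D + 3) = 6 * (D + 3).choose 3 := by
    have := Nat.descFactorial_eq_factorial_mul_choose (D + 3) 3
    simp [Nat.descFactorial_succ, Nat.factorial] at this
    linarith
  nlinarith
end
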